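/- Characterization of critical points of the fractional cost functional: in the setting above (f of class C² and M-Lipschitz in x, L of class C², 0 < α ≤ 1, A ∈ ℝ^d), let St be the solution map assigning to each continuous control v : [a,b] → ℝ^m the unique continuous q^v : [a,b] → ℝ^d with q^v(t) = A + I^α_-(s ↦ f(q^v(s),v(s),s))(t) for all t, and set ℒ^α(v) := ∫_a^b L(q^v(t), v(t), t) dt. Fix a continuous control u, let q := q^u, and let p : [a,b] → ℝ^d be the continuous function satisfying p(t) = I^α_+(s ↦ (∂L/∂x)(q(s),u(s),s) + (∂f/∂x)(q(s),u(s),s)ᵀ · p(s))(t) for all t ∈ [a,b]. Define the Hamiltonian H(x,v,w,t) := L(x,v,t) + w · f(x,v,t). Then u is a critical point of ℒ^α (i.e., for every continuous ū : [a,b] → ℝ^m, lim_{ε→0} (ℒ^α(u + ε ū) - ℒ^α(u))/ε = 0) if and only if (∂H/∂v)(q(t), u(t), p(t), t) = 0 for all t ∈ [a,b]. -/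

import Mathlib

open Set Filter Topology MeasureTheory RealInnerProductSpace

/-- Left Riemann–Liouville fractional integral of order `α` with inferior limit `a`.
(At `t = a` the integral vanishes, so `Ileft a α g a = 0`.) -/
noncomputable def Ileft {E : Type*} [NormedAddCommGroup E] [NormedSpace ℝ E]
    (a α : ℝ) (g : ℝ → E) (t : ℝ) : E :=
  (Real.Gamma α)⁻¹ • ∫ y in a..t, (t - y) ^ (α - 1) • g y

/-- Right Riemann–Liouville fractional integral of order `α` with superior limit `b`.
(At `t = b` the integral vanishes, so `Iright b α g b = 0`.) -/
noncomputable def Iright {E : Type*} [NormedAddCommGroup E] [NormedSpace ℝ E]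
    (b α : ℝ) (g : ℝ → E) (t : ℝ) : E :=
  (Real.Gamma α)⁻¹ • ∫ y in t..b, (y - t) ^ (α - 1) • g y


section RiemannLiouville

variable {E : Type*} [NormedAddCommGroup E]

theorem intervalIntegrable_sub_rpow_smul [NormedSpace ℝ E] {a b α t : ℝ} (hα : 0 < α)
    (ht : t ∈ Icc a b) {g : ℝ → E} (hg : ContinuousOn g (Icc a b)) :
    IntervalIntegrable (fun y => (t - y) ^ (α - 1) • g y) volume a t := by
  have h1 : IntervalIntegrable (fun y : ℝ => y ^ (α - 1)) volume (t - a) 0 :=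
    intervalIntegral.intervalIntegrable_rpow' (by linarith)
  have h2 := h1.comp_sub_left t
  rw [sub_sub_cancel, sub_zero] at h2
  refine h2.smul_continuousOn (hg.mono ?_)
  rw [uIcc_of_le ht.1]
  exact Icc_subset_Icc_right ht.2

theorem intervalIntegrable_rpow_sub_smul [NormedSpace ℝ E] {a b α t : ℝ} (hα : 0 < α)
    (ht : t ∈ Icc a b) {g : ℝ → E} (hg : ContinuousOn g (Icc a b)) :
    IntervalIntegrable (fun y => (y - t) ^ (α - 1) • g y) volume t b := by
  have h1 : IntervalIntegrable (fun y : ℝ => y ^ (α - 1)) volume 0 (b - t) :=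
    intervalIntegral.intervalIntegrable_rpow' (by linarith)
  have h2 := h1.comp_sub_right t
  rw [sub_add_cancel, zero_add] at h2
  refine h2.smul_continuousOn (hg.mono ?_)
  rw [uIcc_of_le ht.2]
  exact Icc_subset_Icc_left ht.1

theorem Ileft_sub [NormedSpace ℝ E] {a b α t : ℝ} (hα : 0 < α)
    (ht : t ∈ Icc a b) {g₁ g₂ : ℝ → E} (hg₁ : ContinuousOn g₁ (Icc a b))
    (hg₂ : ContinuousOn g₂ (Icc a b)) :
    Ileft a α g₁ t - Ileft a α g₂ t = Ileft a α (fun s => g₁ s - g₂ s) t := by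
  simp only [Ileft, smul_sub]
  rw [intervalIntegral.integral_sub (intervalIntegrable_sub_rpow_smul hα ht hg₁)
    (intervalIntegrable_sub_rpow_smul hα ht hg₂), smul_sub]

/-- The left fractional integral contracts exponentially weighted sup norms by `lam ^ (-α)`. -/
theorem norm_Ileft_le_of_norm_le_exp [NormedSpace ℝ E] {a b α t lam C : ℝ} (hα : 0 < α)
    (hlam : 0 < lam) (hC : 0 ≤ C) (ht : t ∈ Icc a b) {g : ℝ → E}
    (hg : ∀ s ∈ Icc a b, ‖g s‖ ≤ C * Real.exp (lam * (s - a))) :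
    ‖Ileft a α g t‖ ≤ C * Real.exp (lam * (t - a)) * (1 / lam) ^ α := by
  have hΓ : 0 < Real.Gamma α := Real.Gamma_pos_of_pos hα
  set w : ℝ → ℝ := fun z => z ^ (α - 1) * Real.exp (-(lam * z)) with hw
  have hw_int := Real.integral_rpow_mul_exp_neg_mul_Ioi hα hlam
  have hw_on : IntegrableOn w (Ioi 0) := by
    refine Integrable.of_integral_ne_zero ?_
    rw [hw_int]
    positivity
  have hw_le : ∫ z in 0..(t - a), w z ≤ (1 / lam) ^ α * Real.Gamma α := by
    rw [← hw_int, intervalIntegral.integral_of_le (sub_nonneg.2 ht.1)]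
    refine setIntegral_mono_set hw_on ?_ (Eventually.of_forall fun z hz => hz.1)
    filter_upwards [ae_restrict_mem measurableSet_Ioi] with z hz
    have : (0 : ℝ) < z := hz
    simp only [Pi.zero_apply]
    positivity
  have hw_ii : IntervalIntegrable w volume 0 (t - a) :=
    (intervalIntegrable_iff_integrableOn_Ioc_of_le (sub_nonneg.2 ht.1)).2
      (hw_on.mono_set fun z hz => hz.1)
  have hw_sub : IntervalIntegrable (fun y => w (t - y)) volume a t := by
    have := (hw_ii.comp_sub_left t).symm
    rwa [sub_sub_cancel, sub_zero] at this
  have key : ‖∫ y in a..t, (t - y) ^ (α - 1) • g y‖ ≤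
      ∫ y in a..t, (C * Real.exp (lam * (t - a))) * w (t - y) := by
    refine intervalIntegral.norm_integral_le_of_norm_le ht.1
      (Eventually.of_forall fun y hy => ?_) (hw_sub.const_mul _)
    have h0 : 0 ≤ t - y := sub_nonneg.2 hy.2
    have h1 : 0 ≤ (t - y) ^ (α - 1) := Real.rpow_nonneg h0 _
    have h2 := hg y ⟨hy.1.le, hy.2.trans ht.2⟩
    rw [norm_smul, Real.norm_of_nonneg h1]
    refine (mul_le_mul_of_nonneg_left h2 h1).trans_eq ?_
    have : Real.exp (lam * (y - a)) =
        Real.exp (lam * (t - a)) * Real.exp (-(lam * (t - y))) := by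
      rw [← Real.exp_add]; ring_nf
    simp only [hw, this]
    ring
  rw [intervalIntegral.integral_const_mul, intervalIntegral.integral_comp_sub_left, sub_self]
    at key
  have hfin := key.trans (mul_le_mul_of_nonneg_left hw_le (by positivity))
  rw [Ileft, norm_smul, norm_inv, Real.norm_of_nonneg hΓ.le, inv_mul_le_iff₀ hΓ]
  linarith

/-- A Gronwall type inequality for the left fractional integral. -/
theorem exists_norm_le_of_eq_Ileft [NormedSpace ℝ E] (a b : ℝ) {α M : ℝ} (hα : 0 < α)
    (hM : 0 ≤ M) :
    ∃ C, 0 ≤ C ∧ ∀ (c : ℝ) (h g : ℝ → E), 0 ≤ c → ContinuousOn h (Icc a b) →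
      (∀ t ∈ Icc a b, h t = Ileft a α g t) → (∀ s ∈ Icc a b, ‖g s‖ ≤ M * ‖h s‖ + c) →
      ∀ t ∈ Icc a b, ‖h t‖ ≤ C * c := by
  set lam : ℝ := (2 * M + 1) ^ (1 / α) with hlam
  have hlam0 : 0 < lam := by positivity
  have hpow : (1 / lam) ^ α = (2 * M + 1)⁻¹ := by
    rw [one_div, Real.inv_rpow hlam0.le, hlam, ← Real.rpow_mul (by positivity),
      one_div_mul_cancel hα.ne', Real.rpow_one]
  refine ⟨Real.exp (lam * (b - a)), (Real.exp_pos _).le, fun c h g hc hh heq hg t ht => ?_⟩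
  have hcont : ContinuousOn (fun s => Real.exp (-(lam * (s - a))) * ‖h s‖) (Icc a b) :=
    (by fun_prop : Continuous fun s => Real.exp (-(lam * (s - a)))).continuousOn.mul hh.norm
  obtain ⟨t₀, ht₀, hmax⟩ := isCompact_Icc.exists_isMaxOn ⟨t, ht⟩ hcont
  set S : ℝ := Real.exp (-(lam * (t₀ - a))) * ‖h t₀‖ with hS
  have hS0 : 0 ≤ S := by positivity
  have hle : ∀ s ∈ Icc a b, ‖h s‖ ≤ S * Real.exp (lam * (s - a)) := fun s hs => by
    have h1 : Real.exp (-(lam * (s - a))) * ‖h s‖ ≤ S := hmax hs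
    rwa [Real.exp_neg, inv_mul_le_iff₀ (Real.exp_pos _), mul_comm] at h1
  have hgle : ∀ s ∈ Icc a b, ‖g s‖ ≤ (M * S + c) * Real.exp (lam * (s - a)) := fun s hs => by
    have h1 : 1 ≤ Real.exp (lam * (s - a)) :=
      Real.one_le_exp (mul_nonneg hlam0.le (sub_nonneg.2 hs.1))
    have h2 := mul_le_mul_of_nonneg_left (hle s hs) hM
    have h3 := hg s hs
    nlinarith
  have h1 := norm_Ileft_le_of_norm_le_exp hα hlam0 (by positivity) ht₀ hgle
  rw [← heq t₀ ht₀, hpow, ← div_eq_mul_inv, le_div_iff₀ (by positivity)] at h1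
  have h2 : S * (2 * M + 1) ≤ M * S + c := by
    rw [hS, Real.exp_neg, mul_assoc, inv_mul_le_iff₀ (Real.exp_pos _), ← Real.exp_neg, ← hS]
    linarith
  have h3 : S ≤ c := by nlinarith
  have h4 : Real.exp (lam * (t - a)) ≤ Real.exp (lam * (b - a)) :=
    Real.exp_le_exp.2 (mul_le_mul_of_nonneg_left (by linarith [ht.2]) hlam0.le)
  calc ‖h t‖ ≤ S * Real.exp (lam * (t - a)) := hle t ht
    _ ≤ c * Real.exp (lam * (b - a)) := by gcongr
    _ = _ := mul_comm _ _

/-- Fractional integration by parts: the left and right fractional integrals are adjoint. -/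
theorem integral_inner_Ileft [InnerProductSpace ℝ E] [CompleteSpace E] {a b α : ℝ} (hab : a ≤ b)
    (hα : 0 < α) {g k : ℝ → E} (hg : ContinuousOn g (Icc a b)) (hk : ContinuousOn k (Icc a b)) :
    ∫ t in a..b, ⟪Ileft a α g t, k t⟫ = ∫ t in a..b, ⟪g t, Iright b α k t⟫ := by
  set K : ℝ → ℝ := (Ioo 0 (b - a)).indicator fun z => z ^ (α - 1) with hK
  set G : ℝ → E := (Ioc a b).indicator g with hG
  set Q : ℝ → E := (Ioc a b).indicator k with hQ
  have hKi : Integrable K := by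
    have h1 : IntervalIntegrable (fun y : ℝ => y ^ (α - 1)) volume 0 (b - a) :=
      intervalIntegral.intervalIntegrable_rpow' (by linarith)
    rw [intervalIntegrable_iff_integrableOn_Ioo_of_le (sub_nonneg.2 hab)] at h1
    exact h1.integrable_indicator measurableSet_Ioo
  have hind : ∀ {w : ℝ → E}, ContinuousOn w (Icc a b) → Integrable ((Ioc a b).indicator w) :=
    fun hw => ((hw.integrableOn_Icc).mono_set Ioc_subset_Icc_self).integrable_indicator
      measurableSet_Ioc
  obtain ⟨C, hC⟩ := isCompact_Icc.exists_bound_of_continuousOn hk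
  have hQC : ∀ t, ‖Q t‖ ≤ max C 0 := fun t => by
    by_cases ht : t ∈ Ioc a b
    · rw [hQ, indicator_of_mem ht]
      exact (hC t (Ioc_subset_Icc_self ht)).trans (le_max_left _ _)
    · rw [hQ, indicator_of_notMem ht, norm_zero]
      exact le_max_right _ _
  have hW : Integrable (fun z : ℝ × ℝ => K (z.1 - z.2) • G z.2) (volume.prod volume) :=
    (hind hg).convolution_integrand (ContinuousLinearMap.lsmul ℝ ℝ).flip hKi
  have hΦ : Integrable (Function.uncurry fun t y : ℝ => ⟪K (t - y) • G y, Q t⟫)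
      (volume.prod volume) := by
    refine (hW.norm.mul_const (max C 0)).mono'
      (hW.aestronglyMeasurable.inner ((hind hk).aestronglyMeasurable.comp_fst))
      (Eventually.of_forall fun z => ?_)
    exact (norm_inner_le_norm _ _).trans (mul_le_mul_of_nonneg_left (hQC _) (norm_nonneg _))
  have hswap := integral_integral_swap hΦ
  have hleft : ∀ t, ∫ y, ⟪K (t - y) • G y, Q t⟫ =
      (Ioc a b).indicator (fun t => ⟪∫ y in a..t, (t - y) ^ (α - 1) • g y, k t⟫) t := fun t => by
    by_cases ht : t ∈ Ioc a b
    · rw [indicator_of_mem ht, real_inner_comm, intervalIntegral.integral_of_le ht.1.le,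
        ← integral_inner ((intervalIntegrable_iff_integrableOn_Ioc_of_le ht.1.le).1
          (intervalIntegrable_sub_rpow_smul hα (Ioc_subset_Icc_self ht) hg)),
        integral_Ioc_eq_integral_Ioo, ← integral_indicator measurableSet_Ioo]
      congr 1 with y
      by_cases hy : y ∈ Ioo a t
      · have h1 : t - y ∈ Ioo 0 (b - a) := ⟨by linarith [hy.2], by linarith [hy.1, ht.2]⟩
        have h2 : y ∈ Ioc a b := ⟨hy.1, by linarith [hy.2, ht.2]⟩
        rw [indicator_of_mem hy, hK, hG, hQ, indicator_of_mem h1, indicator_of_mem h2,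
          indicator_of_mem ht, real_inner_comm]
      · rw [indicator_of_notMem hy]
        by_cases h2 : y ∈ Ioc a b
        · have h1 : t - y ∉ Ioo 0 (b - a) := fun h => hy ⟨h2.1, by linarith [h.1]⟩
          rw [hK, indicator_of_notMem h1, zero_smul, inner_zero_left]
        · rw [hG, indicator_of_notMem h2, smul_zero, inner_zero_left]
    · simp only [hQ, indicator_of_notMem ht, inner_zero_right, integral_zero]
  have hright : ∀ y, ∫ t, ⟪K (t - y) • G y, Q t⟫ =
      (Ioc a b).indicator (fun y => ⟪g y, ∫ t in y..b, (t - y) ^ (α - 1) • k t⟫) y := fun y => by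
    by_cases hy : y ∈ Ioc a b
    · rw [indicator_of_mem hy, intervalIntegral.integral_of_le hy.2,
        ← integral_inner ((intervalIntegrable_iff_integrableOn_Ioc_of_le hy.2).1
          (intervalIntegrable_rpow_sub_smul hα (Ioc_subset_Icc_self hy) hk)),
        ← integral_indicator measurableSet_Ioc]
      congr 1 with t
      by_cases ht : t ∈ Ioc y b
      · have h1 : t - y ∈ Ioo 0 (b - a) := ⟨by linarith [ht.1], by linarith [hy.1, ht.2]⟩
        have h2 : t ∈ Ioc a b := ⟨hy.1.trans ht.1, ht.2⟩
        rw [indicator_of_mem ht, hK, hG, hQ, indicator_of_mem h1, indicator_of_mem h2,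
          indicator_of_mem hy, real_inner_smul_left, real_inner_smul_right]
      · rw [indicator_of_notMem ht]
        by_cases h2 : t ∈ Ioc a b
        · have h1 : t - y ∉ Ioo 0 (b - a) := fun h => ht ⟨by linarith [h.1], h2.2⟩
          rw [hK, indicator_of_notMem h1, zero_smul, inner_zero_left]
        · rw [hQ, indicator_of_notMem h2, inner_zero_right]
    · simp only [hG, indicator_of_notMem hy, smul_zero, inner_zero_left, integral_zero]
  simp only [hleft, hright, integral_indicator measurableSet_Ioc] at hswap
  simp only [Ileft, Iright, real_inner_smul_left, real_inner_smul_right,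
    intervalIntegral.integral_of_le hab, integral_const_mul, hswap]

end RiemannLiouville

section PartialDerivatives

variable {E F G : Type*} [NormedAddCommGroup E] [NormedSpace ℝ E] [NormedAddCommGroup F]
  [NormedSpace ℝ F] [NormedAddCommGroup G] [NormedSpace ℝ G]

theorem hasFDerivAt_slice {a b : ℝ} {f : E → F → ℝ → G}
    (hf : ContDiffOn ℝ 2 (fun z : E × F × ℝ => f z.1 z.2.1 z.2.2) (univ ×ˢ univ ×ˢ Icc a b))
    (x : E) (v : F) {t : ℝ} (ht : t ∈ Icc a b) :
    HasFDerivAt (fun z : E × F => f z.1 z.2 t)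
      ((fderivWithin ℝ (fun z : E × F × ℝ => f z.1 z.2.1 z.2.2) (univ ×ˢ univ ×ˢ Icc a b)
        (x, v, t)).comp ((ContinuousLinearMap.fst ℝ E F).prod
          ((ContinuousLinearMap.snd ℝ E F).prod 0))) (x, v) := by
  have h1 := ((hf (x, v, t) ⟨trivial, trivial, ht⟩).differentiableWithinAt
    two_ne_zero).hasFDerivWithinAt
  have h2 : HasFDerivAt (fun z : E × F => (z.1, z.2, t)) ((ContinuousLinearMap.fst ℝ E F).prod
      ((ContinuousLinearMap.snd ℝ E F).prod 0)) (x, v) :=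
    hasFDerivAt_fst.prodMk (hasFDerivAt_snd.prodMk (hasFDerivAt_const t _))
  exact HasFDerivWithinAt.comp_hasFDerivAt (x, v) (f := fun z : E × F => (z.1, z.2, t)) h1 h2
    (Eventually.of_forall fun z => ⟨trivial, trivial, ht⟩)

theorem hasFDerivAt_coprod_of_partial {a b : ℝ} {f : E → F → ℝ → G}
    (hf : ContDiffOn ℝ 2 (fun z : E × F × ℝ => f z.1 z.2.1 z.2.2) (univ ×ˢ univ ×ˢ Icc a b))
    {fx : E → F → ℝ → (E →L[ℝ] G)} {fv : E → F → ℝ → (F →L[ℝ] G)}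
    (hfx : ∀ x v, ∀ t ∈ Icc a b, HasFDerivAt (fun y => f y v t) (fx x v t) x)
    (hfv : ∀ x v, ∀ t ∈ Icc a b, HasFDerivAt (fun w => f x w t) (fv x v t) v)
    (x : E) (v : F) {t : ℝ} (ht : t ∈ Icc a b) :
    HasFDerivAt (fun z : E × F => f z.1 z.2 t) ((fx x v t).coprod (fv x v t)) (x, v) := by
  have h := hasFDerivAt_slice hf x v ht
  have h1 := (hfx x v t ht).unique (HasFDerivAt.comp (g := fun z : E × F => f z.1 z.2 t)
    (f := fun y => (y, v)) x h (hasFDerivAt_prodMk_left x v))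
  have h2 := (hfv x v t ht).unique (HasFDerivAt.comp (g := fun z : E × F => f z.1 z.2 t)
    (f := fun w => (x, w)) v h (hasFDerivAt_prodMk_right x v))
  rwa [h1, h2, ← ContinuousLinearMap.comp_coprod, ContinuousLinearMap.coprod_inl_inr,
    ContinuousLinearMap.comp_id]

theorem continuousOn_fderivWithin_slab {a b : ℝ} (hab : a < b) {f : E → F → ℝ → G}
    (hf : ContDiffOn ℝ 2 (fun z : E × F × ℝ => f z.1 z.2.1 z.2.2) (univ ×ˢ univ ×ˢ Icc a b))
    {q : ℝ → E} {u : ℝ → F} (hq : ContinuousOn q (Icc a b)) (hu : ContinuousOn u (Icc a b)) :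
    ContinuousOn (fun t => (fderivWithin ℝ (fun z : E × F × ℝ => f z.1 z.2.1 z.2.2)
      (univ ×ˢ univ ×ˢ Icc a b) (q t, u t, t)).comp ((ContinuousLinearMap.fst ℝ E F).prod
          ((ContinuousLinearMap.snd ℝ E F).prod 0))) (Icc a b) := by
  have h1 := hf.continuousOn_fderivWithin
    (uniqueDiffOn_univ.prod (uniqueDiffOn_univ.prod (uniqueDiffOn_Icc hab))) one_le_two
  exact (h1.comp (hq.prodMk (hu.prodMk continuousOn_id))
    fun t ht => ⟨trivial, trivial, ht⟩).clm_comp continuousOn_const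

theorem continuousOn_partials_along {a b : ℝ} (hab : a < b) {f : E → F → ℝ → G}
    (hf : ContDiffOn ℝ 2 (fun z : E × F × ℝ => f z.1 z.2.1 z.2.2) (univ ×ˢ univ ×ˢ Icc a b))
    {fx : E → F → ℝ → (E →L[ℝ] G)} {fv : E → F → ℝ → (F →L[ℝ] G)}
    (hfx : ∀ x v, ∀ t ∈ Icc a b, HasFDerivAt (fun y => f y v t) (fx x v t) x)
    (hfv : ∀ x v, ∀ t ∈ Icc a b, HasFDerivAt (fun w => f x w t) (fv x v t) v)
    {q : ℝ → E} {u : ℝ → F} (hq : ContinuousOn q (Icc a b)) (hu : ContinuousOn u (Icc a b)) :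
    ContinuousOn (fun t => fx (q t) (u t) t) (Icc a b) ∧
      ContinuousOn (fun t => fv (q t) (u t) t) (Icc a b) := by
  have h : ContinuousOn (fun t => (fx (q t) (u t) t).coprod (fv (q t) (u t) t)) (Icc a b) :=
    (continuousOn_fderivWithin_slab hab hf hq hu).congr fun t ht =>
      (hasFDerivAt_coprod_of_partial hf hfx hfv (q t) (u t) ht).unique
        (hasFDerivAt_slice hf (q t) (u t) ht)
  constructor
  · simpa using h.clm_comp (continuousOn_const (c := ContinuousLinearMap.inl ℝ E F))
  · simpa using h.clm_comp (continuousOn_const (c := ContinuousLinearMap.inr ℝ E F))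

/-- A `C²` map is Lipschitz in its first two variables on bounded sets, uniformly in time. -/
theorem exists_lipschitz_on_bounded [FiniteDimensional ℝ E] [FiniteDimensional ℝ F] {a b : ℝ}
    {f : E → F → ℝ → G}
    (hf : ContDiffOn ℝ 2 (fun z : E × F × ℝ => f z.1 z.2.1 z.2.2) (univ ×ˢ univ ×ˢ Icc a b))
    (R R' : ℝ) :
    ∃ K, 0 ≤ K ∧ ∀ x₁ x₂ : E, ∀ v₁ v₂ : F, ∀ t ∈ Icc a b, ‖x₁‖ ≤ R → ‖x₂‖ ≤ R → ‖v₁‖ ≤ R' →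
      ‖v₂‖ ≤ R' → ‖f x₁ v₁ t - f x₂ v₂ t‖ ≤ K * (‖x₁ - x₂‖ + ‖v₁ - v₂‖) := by
  have hE := FiniteDimensional.proper_real E
  have hF := FiniteDimensional.proper_real F
  obtain ⟨K, hK⟩ := (hf.mono (t := Metric.closedBall (0 : E) R ×ˢ Metric.closedBall (0 : F) R' ×ˢ
    Icc a b) (prod_mono (subset_univ _) (prod_mono (subset_univ _) subset_rfl))
    ).exists_lipschitzOnWith two_ne_zero
    ((convex_closedBall _ _).prod ((convex_closedBall _ _).prod (convex_Icc a b)))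
    ((isCompact_closedBall _ _).prod ((isCompact_closedBall _ _).prod isCompact_Icc))
  refine ⟨K, K.2, fun x₁ x₂ v₁ v₂ t ht hx₁ hx₂ hv₁ hv₂ => ?_⟩
  have h := hK.norm_sub_le (x := (x₁, v₁, t)) (by simp [hx₁, hv₁, ht.1, ht.2])
    (y := (x₂, v₂, t)) (by simp [hx₂, hv₂, ht.1, ht.2])
  refine h.trans (mul_le_mul_of_nonneg_left ?_ K.2)
  simp only [Prod.mk_sub_mk, sub_self, Prod.norm_mk, norm_zero]
  have h1 := norm_nonneg (x₁ - x₂)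
  have h2 := norm_nonneg (v₁ - v₂)
  exact max_le (by linarith) (max_le (by linarith) (by linarith))

theorem continuousOn_along {a b : ℝ} {f : E → F → ℝ → G}
    (hf : ContDiffOn ℝ 2 (fun z : E × F × ℝ => f z.1 z.2.1 z.2.2) (univ ×ˢ univ ×ˢ Icc a b))
    {q : ℝ → E} {u : ℝ → F} (hq : ContinuousOn q (Icc a b)) (hu : ContinuousOn u (Icc a b)) :
    ContinuousOn (fun t => f (q t) (u t) t) (Icc a b) :=
  hf.continuousOn.comp (hq.prodMk (hu.prodMk continuousOn_id)) fun _ ht => ⟨trivial, trivial, ht⟩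

end PartialDerivatives

theorem exists_nonneg_bound_of_continuousOn_Icc {E : Type*} [NormedAddCommGroup E] {a b : ℝ}
    {g : ℝ → E} (hg : ContinuousOn g (Icc a b)) : ∃ C, 0 ≤ C ∧ ∀ t ∈ Icc a b, ‖g t‖ ≤ C := by
  obtain ⟨C, hC⟩ := isCompact_Icc.exists_bound_of_continuousOn hg
  exact ⟨max C 0, le_max_right _ _, fun t ht => (hC t ht).trans (le_max_left _ _)⟩

section Variation

variable {E F : Type*} [NormedAddCommGroup E] [InnerProductSpace ℝ E] [FiniteDimensional ℝ E]
  [NormedAddCommGroup F] [InnerProductSpace ℝ F] [FiniteDimensional ℝ F]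

/-- The state variable depends Lipschitz-continuously on the amplitude of a perturbation of the
control. -/
theorem exists_norm_state_sub_le {a b α M : ℝ} (hα : 0 < α) {A : E} {f : E → F → ℝ → E}
    (hf : ContDiffOn ℝ 2 (fun z : E × F × ℝ => f z.1 z.2.1 z.2.2) (univ ×ˢ univ ×ˢ Icc a b))
    (hM : 0 ≤ M)
    (hlip : ∀ x₁ x₂ : E, ∀ v : F, ∀ t ∈ Icc a b, ‖f x₁ v t - f x₂ v t‖ ≤ M * ‖x₁ - x₂‖)
    {St : (ℝ → F) → ℝ → E}
    (hSt : ∀ v : ℝ → F, ContinuousOn v (Icc a b) → ContinuousOn (St v) (Icc a b) ∧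
      ∀ t ∈ Icc a b, St v t = A + Ileft a α (fun s => f (St v s) (v s) s) t)
    {u ub : ℝ → F} (hu : ContinuousOn u (Icc a b)) (hub : ContinuousOn ub (Icc a b)) :
    ∃ C, 0 ≤ C ∧ ∀ ε : ℝ, |ε| ≤ 1 → ∀ t ∈ Icc a b,
      ‖St (fun s => u s + ε • ub s) t - St u t‖ ≤ C * |ε| ∧
      ‖f (St (fun s => u s + ε • ub s) t) (u t + ε • ub t) t - f (St u t) (u t) t‖ ≤ C * |ε| := by
  obtain ⟨R, -, hR⟩ := exists_nonneg_bound_of_continuousOn_Icc (hSt u hu).1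
  obtain ⟨U, hU0, hU⟩ := exists_nonneg_bound_of_continuousOn_Icc hu
  obtain ⟨B, hB0, hB⟩ := exists_nonneg_bound_of_continuousOn_Icc hub
  obtain ⟨K, hK0, hK⟩ := exists_lipschitz_on_bounded hf R (U + B)
  obtain ⟨C, hC0, hC⟩ := exists_norm_le_of_eq_Ileft (E := E) a b hα hM
  have key : ∀ ε : ℝ, |ε| ≤ 1 → ∀ s ∈ Icc a b,
      ‖f (St (fun s => u s + ε • ub s) s) (u s + ε • ub s) s - f (St u s) (u s) s‖ ≤
        M * ‖St (fun s => u s + ε • ub s) s - St u s‖ + K * (B * |ε|) := fun ε hε s hs => by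
    have h1 : ‖ε • ub s‖ ≤ B * |ε| := by
      rw [norm_smul, Real.norm_eq_abs, mul_comm]
      exact mul_le_mul_of_nonneg_right (hB s hs) (abs_nonneg _)
    have h2 : B * |ε| ≤ B := mul_le_of_le_one_right hB0 hε
    have h3 := hK (St u s) (St u s) (u s + ε • ub s) (u s) s hs (hR s hs) (hR s hs)
      ((norm_add_le _ _).trans (by linarith [hU s hs])) (by linarith [hU s hs])
    rw [sub_self, norm_zero, zero_add, add_sub_cancel_left] at h3
    refine (norm_sub_le_norm_sub_add_norm_sub _ (f (St u s) (u s + ε • ub s) s) _).trans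
      (add_le_add (hlip _ _ _ s hs) (h3.trans (mul_le_mul_of_nonneg_left h1 hK0)))
  have hstate : ∀ ε : ℝ, |ε| ≤ 1 → ∀ t ∈ Icc a b,
      ‖St (fun s => u s + ε • ub s) t - St u t‖ ≤ C * (K * (B * |ε|)) := fun ε hε => by
    have hue : ContinuousOn (fun s => u s + ε • ub s) (Icc a b) := hu.add (hub.const_smul ε)
    refine hC _ (fun t => St (fun s => u s + ε • ub s) t - St u t)
      (fun s => f (St (fun s => u s + ε • ub s) s) (u s + ε • ub s) s - f (St u s) (u s) s)
      (by positivity) ((hSt _ hue).1.sub (hSt u hu).1) (fun t ht => ?_) (key ε hε)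
    rw [(hSt _ hue).2 t ht, (hSt u hu).2 t ht, add_sub_add_left_eq_sub]
    exact Ileft_sub hα ht (continuousOn_along hf (hSt _ hue).1 hue)
      (continuousOn_along hf (hSt u hu).1 hu)
  refine ⟨C * K * B + (M * (C * K * B) + K * B), by positivity, fun ε hε t ht => ⟨?_, ?_⟩⟩
  · refine (hstate ε hε t ht).trans ?_
    have : 0 ≤ (M * (C * K * B) + K * B) * |ε| := by positivity
    linarith
  · refine (key ε hε t ht).trans ?_
    have h1 := mul_le_mul_of_nonneg_left (hstate ε hε t ht) hM
    have : 0 ≤ C * K * B * |ε| := by positivity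
    linarith

/-- The Gâteaux derivative of the fractional cost functional, expressed with the adjoint
variable. -/
theorem tendsto_cost_difference_quotient [CompleteSpace E] [CompleteSpace F] {a b α M : ℝ}
    (hab : a < b) (hα : 0 < α) {A : E} {f : E → F → ℝ → E}
    (hf : ContDiffOn ℝ 2 (fun z : E × F × ℝ => f z.1 z.2.1 z.2.2) (univ ×ˢ univ ×ˢ Icc a b))
    (hM : 0 ≤ M)
    (hlip : ∀ x₁ x₂ : E, ∀ v : F, ∀ t ∈ Icc a b, ‖f x₁ v t - f x₂ v t‖ ≤ M * ‖x₁ - x₂‖)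
    {L : E → F → ℝ → ℝ}
    (hL : ContDiffOn ℝ 2 (fun z : E × F × ℝ => L z.1 z.2.1 z.2.2) (univ ×ˢ univ ×ˢ Icc a b))
    {fx : E → F → ℝ → (E →L[ℝ] E)} {fv : E → F → ℝ → (F →L[ℝ] E)}
    (hfx : ∀ x v, ∀ t ∈ Icc a b, HasFDerivAt (fun y => f y v t) (fx x v t) x)
    (hfv : ∀ x v, ∀ t ∈ Icc a b, HasFDerivAt (fun w => f x w t) (fv x v t) v)
    {Lx : E → F → ℝ → E} {Lv : E → F → ℝ → F}
    (hLx : ∀ x v, ∀ t ∈ Icc a b, HasGradientAt (fun y => L y v t) (Lx x v t) x)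
    (hLv : ∀ x v, ∀ t ∈ Icc a b, HasGradientAt (fun w => L x w t) (Lv x v t) v)
    {St : (ℝ → F) → ℝ → E}
    (hSt : ∀ v : ℝ → F, ContinuousOn v (Icc a b) → ContinuousOn (St v) (Icc a b) ∧
      ∀ t ∈ Icc a b, St v t = A + Ileft a α (fun s => f (St v s) (v s) s) t)
    {u : ℝ → F} (hu : ContinuousOn u (Icc a b))
    {p : ℝ → E} (hpc : ContinuousOn p (Icc a b))
    (hp : ∀ t ∈ Icc a b, p t = Iright b α (fun s => Lx (St u s) (u s) s +
      ContinuousLinearMap.adjoint (fx (St u s) (u s) s) (p s)) t)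
    {ub : ℝ → F} (hub : ContinuousOn ub (Icc a b)) :
    ContinuousOn (fun t => Lv (St u t) (u t) t +
      ContinuousLinearMap.adjoint (fv (St u t) (u t) t) (p t)) (Icc a b) ∧
    Tendsto (fun ε : ℝ => ε⁻¹ *
          ((∫ t in a..b, L (St (fun s => u s + ε • ub s) t) (u t + ε • ub t) t) -
            ∫ t in a..b, L (St u t) (u t) t)) (𝓝[≠] 0)
      (𝓝 (∫ t in a..b, ⟪Lv (St u t) (u t) t +
          ContinuousLinearMap.adjoint (fv (St u t) (u t) t) (p t), ub t⟫)) := by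
  have hLx' : ∀ x v, ∀ t ∈ Icc a b,
      HasFDerivAt (fun y => L y v t) (InnerProductSpace.toDual ℝ E (Lx x v t)) x :=
    fun x v t ht => (hLx x v t ht).hasFDerivAt
  have hLv' : ∀ x v, ∀ t ∈ Icc a b,
      HasFDerivAt (fun w => L x w t) (InnerProductSpace.toDual ℝ F (Lv x v t)) v :=
    fun x v t ht => (hLv x v t ht).hasFDerivAt
  have hq := (hSt u hu).1
  obtain ⟨hfxc, hfvc⟩ := continuousOn_partials_along hab hf hfx hfv hq hu
  obtain ⟨hLxc', hLvc'⟩ := continuousOn_partials_along hab hL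
    (fx := fun x v t => InnerProductSpace.toDual ℝ E (Lx x v t))
    (fv := fun x v t => InnerProductSpace.toDual ℝ F (Lv x v t)) hLx' hLv' hq hu
  have hLxc : ContinuousOn (fun t => Lx (St u t) (u t) t) (Icc a b) := by
    refine ((InnerProductSpace.toDual ℝ E).symm.continuous.comp_continuousOn hLxc').congr
      fun t _ => ?_
    exact ((InnerProductSpace.toDual ℝ E).symm_apply_apply _).symm
  have hLvc : ContinuousOn (fun t => Lv (St u t) (u t) t) (Icc a b) := by
    refine ((InnerProductSpace.toDual ℝ F).symm.continuous.comp_continuousOn hLvc').congr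
      fun t _ => ?_
    exact ((InnerProductSpace.toDual ℝ F).symm_apply_apply _).symm
  set k : ℝ → E := fun s => Lx (St u s) (u s) s +
    ContinuousLinearMap.adjoint (fx (St u s) (u s) s) (p s) with hk_def
  have hk : ContinuousOn k (Icc a b) := hLxc.add
    (((ContinuousLinearMap.adjoint (𝕜 := ℝ) (E := E) (F := E)).continuous.comp_continuousOn
      hfxc).clm_apply hpc)
  refine ⟨hLvc.add (((ContinuousLinearMap.adjoint (𝕜 := ℝ) (E := F) (F := E)).continuous
    |>.comp_continuousOn hfvc).clm_apply hpc), ?_⟩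
  set h : ℝ → ℝ → E := fun ε t => St (fun s => u s + ε • ub s) t - St u t with hh_def
  set g : ℝ → ℝ → E := fun ε t =>
    f (St (fun s => u s + ε • ub s) t) (u t + ε • ub t) t - f (St u t) (u t) t with hg_def
  set l : ℝ → ℝ → ℝ := fun ε t =>
    L (St (fun s => u s + ε • ub s) t) (u t + ε • ub t) t - L (St u t) (u t) t with hl_def
  have hue : ∀ ε : ℝ, ContinuousOn (fun s => u s + ε • ub s) (Icc a b) :=
    fun ε => hu.add (hub.const_smul ε)
  have hhc : ∀ ε, ContinuousOn (h ε) (Icc a b) := fun ε => (hSt _ (hue ε)).1.sub hq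
  have hgc : ∀ ε, ContinuousOn (g ε) (Icc a b) := fun ε =>
    (continuousOn_along hf (hSt _ (hue ε)).1 (hue ε)).sub (continuousOn_along hf hq hu)
  have hlc : ∀ ε, ContinuousOn (l ε) (Icc a b) := fun ε =>
    (continuousOn_along hL (hSt _ (hue ε)).1 (hue ε)).sub (continuousOn_along hL hq hu)
  have hheq : ∀ ε, ∀ t ∈ Icc a b, h ε t = Ileft a α (g ε) t := fun ε t ht => by
    simp only [hh_def]
    rw [(hSt _ (hue ε)).2 t ht, (hSt u hu).2 t ht, add_sub_add_left_eq_sub]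
    exact Ileft_sub hα ht (continuousOn_along hf (hSt _ (hue ε)).1 (hue ε))
      (continuousOn_along hf hq hu)
  have hii : ∀ {w : ℝ → ℝ}, ContinuousOn w (Icc a b) → IntervalIntegrable w volume a b :=
    fun hw => hw.intervalIntegrable_of_Icc hab.le
  have hIcc : ∀ {t}, t ∈ uIoc a b → t ∈ Icc a b := fun ht => by
    rw [uIoc_of_le hab.le] at ht
    exact Ioc_subset_Icc_self ht
  have hdual : ∀ ε, ∫ t in a..b, ⟪h ε t, k t⟫ = ∫ t in a..b, ⟪g ε t, p t⟫ := fun ε => by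
    rw [intervalIntegral.integral_congr (g := fun t => ⟪Ileft a α (g ε) t, k t⟫)
      fun t ht => by
        rw [uIcc_of_le hab.le] at ht
        simp only [hheq ε t ht],
      integral_inner_Ileft hab.le hα (hgc ε) hk]
    refine intervalIntegral.integral_congr fun t ht => ?_
    rw [uIcc_of_le hab.le] at ht
    simp only [hp t ht]
  set Ψ : ℝ → ℝ → ℝ := fun ε t => ε⁻¹ * (l ε t + ⟪g ε t, p t⟫ - ⟪h ε t, k t⟫) with hΨ_def
  have hΨc : ∀ ε, ContinuousOn (Ψ ε) (Icc a b) := fun ε => continuousOn_const.mul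
    (((hlc ε).add ((hgc ε).inner hpc)).sub ((hhc ε).inner hk))
  have hcost : ∀ ε : ℝ, ε⁻¹ *
      ((∫ t in a..b, L (St (fun s => u s + ε • ub s) t) (u t + ε • ub t) t) -
        ∫ t in a..b, L (St u t) (u t) t) = ∫ t in a..b, Ψ ε t := fun ε => by
    rw [intervalIntegral.integral_const_mul,
      intervalIntegral.integral_sub (f := fun t => l ε t + ⟪g ε t, p t⟫)
        (hii ((hlc ε).add ((hgc ε).inner hpc))) (hii ((hhc ε).inner hk)),
      intervalIntegral.integral_add (hii (hlc ε)) (hii ((hgc ε).inner hpc)), hdual ε,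
      add_sub_cancel_right,
      intervalIntegral.integral_sub (hii (continuousOn_along hL (hSt _ (hue ε)).1 (hue ε)))
        (hii (continuousOn_along hL hq hu))]
  simp only [hcost]
  obtain ⟨C, hC0, hC⟩ := exists_norm_state_sub_le hα hf hM hlip hSt hu hub
  obtain ⟨R, -, hR⟩ := exists_nonneg_bound_of_continuousOn_Icc hq
  obtain ⟨U, hU0, hU⟩ := exists_nonneg_bound_of_continuousOn_Icc hu
  obtain ⟨B, hB0, hB⟩ := exists_nonneg_bound_of_continuousOn_Icc hub
  obtain ⟨P, hP0, hP⟩ := exists_nonneg_bound_of_continuousOn_Icc hpc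
  obtain ⟨Q, hQ0, hQ⟩ := exists_nonneg_bound_of_continuousOn_Icc hk
  obtain ⟨K, hK0, hK⟩ := exists_lipschitz_on_bounded hL (R + C) (U + B)
  have hub_le : ∀ ε : ℝ, ∀ t ∈ Icc a b, ‖ε • ub t‖ ≤ B * |ε| := fun ε t ht => by
    rw [norm_smul, Real.norm_eq_abs, mul_comm]
    exact mul_le_mul_of_nonneg_right (hB t ht) (abs_nonneg _)
  have hl_le : ∀ ε : ℝ, |ε| ≤ 1 → ∀ t ∈ Icc a b, ‖l ε t‖ ≤ K * (C + B) * |ε| :=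
    fun ε hε t ht => by
    have h1 := (hC ε hε t ht).1
    have h2 := hub_le ε t ht
    have h3 : C * |ε| ≤ C := mul_le_of_le_one_right hC0 hε
    have h4 : B * |ε| ≤ B := mul_le_of_le_one_right hB0 hε
    have h5 : ‖St (fun s => u s + ε • ub s) t‖ ≤ R + C := by
      have := norm_le_norm_add_norm_sub' (St (fun s => u s + ε • ub s) t) (St u t)
      linarith [hR t ht]
    have h6 := hK (St (fun s => u s + ε • ub s) t) (St u t) (u t + ε • ub t) (u t) t ht h5
      (by linarith [hR t ht]) ((norm_add_le _ _).trans (by linarith [hU t ht]))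
      (by linarith [hU t ht])
    rw [add_sub_cancel_left] at h6
    refine h6.trans ?_
    rw [mul_assoc]
    exact mul_le_mul_of_nonneg_left (by linarith) hK0
  have hsmall : ∀ᶠ ε : ℝ in 𝓝[≠] 0, ε ≠ 0 ∧ |ε| ≤ 1 := by
    refine (eventually_mem_nhdsWithin).and (eventually_nhdsWithin_of_eventually_nhds ?_)
    filter_upwards [Metric.closedBall_mem_nhds (0 : ℝ) one_pos] with ε hε
    simpa using hε
  refine intervalIntegral.tendsto_integral_filter_of_dominated_convergence
    (fun _ => K * (C + B) + C * P + C * Q) (Eventually.of_forall fun ε => ?_) ?_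
    intervalIntegrable_const (Eventually.of_forall fun t ht => ?_)
  · rw [uIoc_of_le hab.le]
    exact ((hΨc ε).mono Ioc_subset_Icc_self).aestronglyMeasurable measurableSet_Ioc
  · filter_upwards [hsmall] with ε hε
    refine Eventually.of_forall fun t ht => ?_
    have ht := hIcc ht
    have hε0 : 0 < |ε| := abs_pos.2 hε.1
    have h1 := hl_le ε hε.2 t ht
    have h2 : ‖⟪g ε t, p t⟫‖ ≤ C * |ε| * P := (norm_inner_le_norm _ _).trans
      (mul_le_mul (hC ε hε.2 t ht).2 (hP t ht) (norm_nonneg _) (by positivity))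
    have h3 : ‖⟪h ε t, k t⟫‖ ≤ C * |ε| * Q := (norm_inner_le_norm _ _).trans
      (mul_le_mul (hC ε hε.2 t ht).1 (hQ t ht) (norm_nonneg _) (by positivity))
    simp only [hΨ_def]
    rw [norm_mul, norm_inv, Real.norm_eq_abs ε, inv_mul_le_iff₀ hε0]
    have h4 := norm_sub_le (l ε t + ⟪g ε t, p t⟫) ⟪h ε t, k t⟫
    have h5 := norm_add_le (l ε t) ⟪g ε t, p t⟫
    linarith
  · have ht := hIcc ht
    have hD := (hasFDerivAt_coprod_of_partial hL hLx' hLv' (St u t) (u t) ht).add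
      ((innerSL ℝ (p t)).hasFDerivAt.comp (St u t, u t)
        (hasFDerivAt_coprod_of_partial hf hfx hfv (St u t) (u t) ht))
    set z : ℝ → E × F := fun ε => (St (fun s => u s + ε • ub s) t, u t + ε • ub t) with hz_def
    have hz_sub : ∀ ε, z ε - (St u t, u t) = (h ε t, ε • ub t) := fun ε => by
      simp [hz_def, hh_def]
    have hzO : (fun ε => z ε - (St u t, u t)) =O[𝓝[≠] 0] fun ε : ℝ => ε := by
      refine Asymptotics.IsBigO.of_bound (C + B) ?_
      filter_upwards [hsmall] with ε hε
      rw [hz_sub, Prod.norm_mk, Real.norm_eq_abs]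
      have h1 := (hC ε hε.2 t ht).1
      have h2 := hub_le ε t ht
      have h3 : 0 ≤ C * |ε| := by positivity
      have h4 : 0 ≤ B * |ε| := by positivity
      exact max_le (by simp only [hh_def]; linarith) (by linarith)
    have hz : Tendsto z (𝓝[≠] 0) (𝓝 (St u t, u t)) := tendsto_sub_nhds_zero_iff.1
      (hzO.trans_tendsto (tendsto_nhdsWithin_of_tendsto_nhds tendsto_id))
    have hlim := ((hD.isLittleO.comp_tendsto hz).trans_isBigO hzO).tendsto_inv_smul_nhds_zero
    have hlim' := hlim.add_const ⟪Lv (St u t) (u t) t +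
      ContinuousLinearMap.adjoint (fv (St u t) (u t) t) (p t), ub t⟫
    rw [zero_add] at hlim'
    refine hlim'.congr' ?_
    filter_upwards [hsmall] with ε hε
    have hε0 : ε ≠ 0 := hε.1
    simp only [Function.comp_apply, hz_sub, hΨ_def, real_inner_comm (k t),
      real_inner_comm (p t)]
    simp only [hz_def, hk_def, hl_def, hg_def, Pi.add_apply, Function.comp_apply,
      _root_.add_apply, ContinuousLinearMap.comp_apply,
      ContinuousLinearMap.coprod_apply, InnerProductSpace.toDual_apply_apply,
      innerSL_apply_apply, inner_add_right, inner_add_left, inner_sub_right,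
      ContinuousLinearMap.adjoint_inner_left, map_smul, inner_smul_right, smul_eq_mul]
    field_simp
    ring

end Variation

/-- Characterization of critical points of the fractional cost functional
`ℒ^α(v) = ∫_a^b L(q^{v,α}, v, t) dt`: a control `u` is a critical point of `ℒ^α` if and only
if the fractional stationary equation `(∂H/∂v)(q,u,p,t) = 0` holds on `[a,b]`, where
`H(x,v,w,t) = L(x,v,t) + w·f(x,v,t)`, `q = q^{u,α}` and `p` is the adjoint variable. -/
theorem critical_point_iff_stationary_equation
    (a b : ℝ) (hab : a < b) (d m : ℕ) (hd : 0 < d) (hm : 0 < m)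
    (α : ℝ) (hα0 : 0 < α) (hα1 : α ≤ 1)
    (A : EuclideanSpace ℝ (Fin d))
    (f : EuclideanSpace ℝ (Fin d) → EuclideanSpace ℝ (Fin m) → ℝ → EuclideanSpace ℝ (Fin d))
    (hf : ContDiffOn ℝ 2
      (fun p : EuclideanSpace ℝ (Fin d) × EuclideanSpace ℝ (Fin m) × ℝ => f p.1 p.2.1 p.2.2)
      (univ ×ˢ univ ×ˢ Icc a b))
    (M : ℝ) (hM : 0 ≤ M)
    (hlip : ∀ x₁ x₂ : EuclideanSpace ℝ (Fin d), ∀ v : EuclideanSpace ℝ (Fin m), ∀ t ∈ Icc a b,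
      ‖f x₁ v t - f x₂ v t‖ ≤ M * ‖x₁ - x₂‖)
    (L : EuclideanSpace ℝ (Fin d) → EuclideanSpace ℝ (Fin m) → ℝ → ℝ)
    (hL : ContDiffOn ℝ 2
      (fun p : EuclideanSpace ℝ (Fin d) × EuclideanSpace ℝ (Fin m) × ℝ => L p.1 p.2.1 p.2.2)
      (univ ×ˢ univ ×ˢ Icc a b))
    -- partial differentials of `f` and partial gradients of `L` in the first two variables
    (fx : EuclideanSpace ℝ (Fin d) → EuclideanSpace ℝ (Fin m) → ℝ →
      (EuclideanSpace ℝ (Fin d) →L[ℝ] EuclideanSpace ℝ (Fin d)))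
    (fv : EuclideanSpace ℝ (Fin d) → EuclideanSpace ℝ (Fin m) → ℝ →
      (EuclideanSpace ℝ (Fin m) →L[ℝ] EuclideanSpace ℝ (Fin d)))
    (hfx : ∀ x v, ∀ t ∈ Icc a b, HasFDerivAt (fun y => f y v t) (fx x v t) x)
    (hfv : ∀ x v, ∀ t ∈ Icc a b, HasFDerivAt (fun w => f x w t) (fv x v t) v)
    (Lx : EuclideanSpace ℝ (Fin d) → EuclideanSpace ℝ (Fin m) → ℝ → EuclideanSpace ℝ (Fin d))
    (Lv : EuclideanSpace ℝ (Fin d) → EuclideanSpace ℝ (Fin m) → ℝ → EuclideanSpace ℝ (Fin m))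
    (hLx : ∀ x v, ∀ t ∈ Icc a b, HasGradientAt (fun y => L y v t) (Lx x v t) x)
    (hLv : ∀ x v, ∀ t ∈ Icc a b, HasGradientAt (fun w => L x w t) (Lv x v t) v)
    -- the solution map `v ↦ q^{v,α}` of the controlled fractional Cauchy problem
    (St : (ℝ → EuclideanSpace ℝ (Fin m)) → ℝ → EuclideanSpace ℝ (Fin d))
    (hSt : ∀ v : ℝ → EuclideanSpace ℝ (Fin m), ContinuousOn v (Icc a b) →
      ContinuousOn (St v) (Icc a b) ∧
        ∀ t ∈ Icc a b, St v t = A + Ileft a α (fun s => f (St v s) (v s) s) t)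
    -- the fixed control `u` and the adjoint variable `p`
    (u : ℝ → EuclideanSpace ℝ (Fin m)) (hu : ContinuousOn u (Icc a b))
    (p : ℝ → EuclideanSpace ℝ (Fin d)) (hpc : ContinuousOn p (Icc a b))
    (hp : ∀ t ∈ Icc a b, p t = Iright b α
      (fun s => Lx (St u s) (u s) s +
        ContinuousLinearMap.adjoint (fx (St u s) (u s) s) (p s)) t) :
    -- `u` is a critical point of the cost functional `ℒ^α` …
    ((∀ ub : ℝ → EuclideanSpace ℝ (Fin m), ContinuousOn ub (Icc a b) →
      Tendsto (fun ε : ℝ => ε⁻¹ *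
          ((∫ t in a..b, L (St (fun s => u s + ε • ub s) t) (u t + ε • ub t) t) -
            ∫ t in a..b, L (St u t) (u t) t))
        (𝓝[≠] 0) (𝓝 0))
    -- … if and only if the fractional stationary equation `∂H/∂v = 0` holds on `[a,b]`
    ↔ (∀ t ∈ Icc a b,
        Lv (St u t) (u t) t +
          ContinuousLinearMap.adjoint (fv (St u t) (u t) t) (p t) = 0)) := by
  have hderiv := fun (ub : ℝ → EuclideanSpace ℝ (Fin m)) (hub : ContinuousOn ub (Icc a b)) =>
    tendsto_cost_difference_quotient hab hα0 hf hM hlip hL hfx hfv hLx hLv hSt hu hpc hp hub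
  constructor
  · intro hcrit
    have hcont := (hderiv u hu).1
    have h0 := tendsto_nhds_unique (hderiv _ hcont).2 (hcrit _ hcont)
    by_contra! hne
    obtain ⟨t, ht, hne⟩ := hne
    exact (intervalIntegral.integral_pos hab (hcont.inner hcont)
      (fun s _ => real_inner_self_nonneg) ⟨t, ht, real_inner_self_pos.2 hne⟩).ne' h0
  · intro hstat ub hub
    have hzero : ∫ t in a..b, ⟪Lv (St u t) (u t) t +
        ContinuousLinearMap.adjoint (fv (St u t) (u t) t) (p t), ub t⟫ = 0 := by
      rw [← intervalIntegral.integral_zero (a := a) (b := b) (μ := volume) (E := ℝ)]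
      refine intervalIntegral.integral_congr fun t ht => ?_
      rw [uIcc_of_le hab.le] at ht
      simp only [hstat t ht, inner_zero_left]
    exact hzero ▸ (hderiv ub hub).2
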